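/- Let γ ≥ 0 and p > γ + 1. There exists a constant C > 0 such that for every smooth compactly supported f: ℝⁿ × ℝᵐ → ℝ, ∫ |x|^{2γ} N^{2(p−γ−1)} f² dμ ≤ C ( ∫ |∇_γ f|² dμ + ∫ f² dμ ). -/

import Mathlib

open MeasureTheory

/-- The Grushin Kaplan norm `N(x,y) = (|x|^{2(1+γ)} + (1+γ)²|y|²)^{1/(2+2γ)}` on `ℝⁿ × ℝᵐ`. -/
noncomputable def GKaplan (n m : ℕ) (γ : ℝ)
    (w : EuclideanSpace ℝ (Fin n) × EuclideanSpace ℝ (Fin m)) : ℝ :=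
  (‖w.1‖ ^ (2 * (1 + γ)) + (1 + γ) ^ 2 * ‖w.2‖ ^ 2) ^ (1 / (2 + 2 * γ))

/-- Partial derivative `∂_{x_i} f` in the `i`-th coordinate of the `x`-variable. -/
noncomputable def dX (n m : ℕ)
    (f : EuclideanSpace ℝ (Fin n) × EuclideanSpace ℝ (Fin m) → ℝ)
    (w : EuclideanSpace ℝ (Fin n) × EuclideanSpace ℝ (Fin m)) (i : Fin n) : ℝ :=
  fderiv ℝ f w (EuclideanSpace.single i (1 : ℝ), 0)

/-- Partial derivative `∂_{y_j} f` in the `j`-th coordinate of the `y`-variable. -/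
noncomputable def dY (n m : ℕ)
    (f : EuclideanSpace ℝ (Fin n) × EuclideanSpace ℝ (Fin m) → ℝ)
    (w : EuclideanSpace ℝ (Fin n) × EuclideanSpace ℝ (Fin m)) (j : Fin m) : ℝ :=
  fderiv ℝ f w (0, EuclideanSpace.single j (1 : ℝ))

/-- The squared length of the Grushin subgradient:
`|∇_γ f|² = |∇_x f|² + |x|^{2γ} |∇_y f|²`. -/
noncomputable def gradSqG (n m : ℕ) (γ : ℝ)
    (f : EuclideanSpace ℝ (Fin n) × EuclideanSpace ℝ (Fin m) → ℝ)
    (w : EuclideanSpace ℝ (Fin n) × EuclideanSpace ℝ (Fin m)) : ℝ :=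
  (∑ i, (dX n m f w i) ^ 2) + ‖w.1‖ ^ (2 * γ) * ∑ j, (dY n m f w j) ^ 2

/-- The probability measure `dμ = Z⁻¹ e^{-N^p} dξ` on `ℝⁿ × ℝᵐ` in the Grushin setting. -/
noncomputable def muG (n m : ℕ) (γ p : ℝ) :
    Measure (EuclideanSpace ℝ (Fin n) × EuclideanSpace ℝ (Fin m)) :=
  volume.withDensity (fun w => ENNReal.ofReal
    ((∫ v : EuclideanSpace ℝ (Fin n) × EuclideanSpace ℝ (Fin m),
        Real.exp (-(GKaplan n m γ v) ^ p))⁻¹ * Real.exp (-(GKaplan n m γ w) ^ p)))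

section Dilation

variable {E F : Type*} [NormedAddCommGroup E] [NormedSpace ℝ E] [NormedAddCommGroup F]
  [NormedSpace ℝ F]

/-- The anisotropic dilation `(x, y) ↦ (eᵗ x, e^{αt} y)`. -/
noncomputable def expDilation (α t : ℝ) (w : E × F) : E × F :=
  (Real.exp t • w.1, Real.exp (α * t) • w.2)

theorem continuous_expDilation (α t : ℝ) : Continuous (expDilation α t : E × F → E × F) := by
  unfold expDilation
  fun_prop

theorem expDilation_zero (α : ℝ) (w : E × F) : expDilation α 0 w = w := by
  simp [expDilation]

theorem norm_le_exp_mul_norm_expDilation {α t : ℝ} (hα : 1 ≤ α) (ht : |t| ≤ 1) (w : E × F) :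
    ‖w‖ ≤ Real.exp α * ‖expDilation α t w‖ := by
  have ht' := abs_le.1 ht
  have key (u : ℝ) (hu : -α ≤ u) (a : ℝ) (ha : 0 ≤ a) :
      a ≤ Real.exp α * (Real.exp u * a) := by
    rw [← mul_assoc, ← Real.exp_add]
    exact le_mul_of_one_le_left ha (Real.one_le_exp (by linarith))
  refine max_le ((key t (by linarith) _ (norm_nonneg w.1)).trans ?_)
    ((key (α * t) (by nlinarith) _ (norm_nonneg w.2)).trans ?_)
  · gcongr
    simpa only [expDilation, norm_smul, Real.norm_eq_abs, Real.abs_exp] using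
      norm_fst_le (expDilation α t w)
  · gcongr
    simpa only [expDilation, norm_smul, Real.norm_eq_abs, Real.abs_exp] using
      norm_snd_le (expDilation α t w)

variable [FiniteDimensional ℝ E] [FiniteDimensional ℝ F] [MeasurableSpace E] [BorelSpace E]
  [MeasurableSpace F] [BorelSpace F] (μ : Measure E) (ν : Measure F)
  [μ.IsAddHaarMeasure] [ν.IsAddHaarMeasure]

theorem integral_comp_expDilation {α t : ℝ} (hα : 1 ≤ α) (ht : |t| ≤ 1) {f : E × F → ℝ}
    (hf : Continuous f) (hfs : HasCompactSupport f) :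
    ∫ w, f (expDilation α t w) ∂(μ.prod ν) =
      Real.exp (-((Module.finrank ℝ E + Module.finrank ℝ F * α) * t)) * ∫ w, f w ∂(μ.prod ν) := by
  have hi : Integrable f (μ.prod ν) := hf.integrable_of_hasCompactSupport hfs
  have hi' : Integrable (fun w => f (expDilation α t w)) (μ.prod ν) := by
    refine (hf.comp (continuous_expDilation α t)).integrable_of_hasCompactSupport ?_
    obtain ⟨R, hR⟩ := hfs.isCompact.isBounded.exists_norm_le
    refine HasCompactSupport.intro (isCompact_closedBall (0 : E × F) (Real.exp α * R)) ?_
    intro w hw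
    by_contra hne
    refine hw ?_
    rw [mem_closedBall_zero_iff]
    refine (norm_le_exp_mul_norm_expDilation hα ht w).trans ?_
    gcongr
    exact hR _ (subset_tsupport f hne)
  rw [integral_prod _ hi', integral_prod _ hi]
  have h1 : ∀ x : E, ∫ y, f (expDilation α t (x, y)) ∂ν =
      Real.exp (-(Module.finrank ℝ F * α * t)) * ∫ y, f (Real.exp t • x, y) ∂ν := by
    intro x
    have := Measure.integral_comp_smul ν (fun y => f (Real.exp t • x, y)) (Real.exp (α * t))
    simp only [expDilation]
    rw [this, smul_eq_mul, abs_of_pos (by positivity), ← Real.exp_nat_mul, ← Real.exp_neg]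
    ring_nf
  simp_rw [h1]
  rw [integral_const_mul,
    Measure.integral_comp_smul μ (fun x => ∫ y, f (x, y) ∂ν) (Real.exp t),
    smul_eq_mul, abs_of_pos (by positivity), ← Real.exp_nat_mul, ← Real.exp_neg, ← mul_assoc,
    ← Real.exp_add]
  ring_nf

/-- The divergence theorem for the generator of the dilations. -/
theorem integral_expDilation_deriv {α : ℝ} (hα : 1 ≤ α) {f f' : E × F → ℝ}
    (hf : Continuous f) (hfs : HasCompactSupport f) (hf' : Continuous f')
    (hfs' : HasCompactSupport f')
    (hd : ∀ w t, HasDerivAt (fun t => f (expDilation α t w)) (f' (expDilation α t w)) t) :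
    ∫ w, f' w ∂(μ.prod ν) =
      -((Module.finrank ℝ E + Module.finrank ℝ F * α) * ∫ w, f w ∂(μ.prod ν)) := by
  obtain ⟨M, hM⟩ := hfs'.exists_bound_of_continuous hf'
  obtain ⟨R, hR⟩ := hfs'.isCompact.isBounded.exists_norm_le
  set K := Metric.closedBall (0 : E × F) (Real.exp α * R)
  have hball : Metric.ball (0 : ℝ) 1 ∈ nhds (0 : ℝ) := Metric.ball_mem_nhds _ one_pos
  have h1 := (hasDerivAt_integral_of_dominated_loc_of_deriv_le (μ := μ.prod ν)
    (F := fun t w => f (expDilation α t w)) (F' := fun t w => f' (expDilation α t w))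
    (x₀ := (0 : ℝ)) (bound := K.indicator fun _ => M) hball
    (Filter.Eventually.of_forall fun t =>
      (hf.comp (continuous_expDilation α t)).aestronglyMeasurable)
    (by simpa only [expDilation_zero] using hf.integrable_of_hasCompactSupport hfs)
    (hf'.comp (continuous_expDilation α 0)).aestronglyMeasurable
    (Filter.Eventually.of_forall fun w t ht => by
      by_cases hw : f' (expDilation α t w) = 0
      · rw [hw, norm_zero]
        exact Set.indicator_nonneg (fun _ _ => (norm_nonneg _).trans (hM 0)) _
      · rw [Set.indicator_of_mem]
        · exact hM _
        · rw [mem_closedBall_zero_iff]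
          refine (norm_le_exp_mul_norm_expDilation (t := t) hα ?_ w).trans ?_
          · simpa using (mem_ball_zero_iff.1 ht).le
          · gcongr
            exact hR _ (subset_tsupport f' hw))
    ((integrable_indicator_iff Metric.isClosed_closedBall.measurableSet).2
      (integrableOn_const (isCompact_closedBall _ _).measure_lt_top.ne))
    (Filter.Eventually.of_forall fun w t _ => hd w t)).2
  set Q : ℝ := Module.finrank ℝ E + Module.finrank ℝ F * α
  have h2 : HasDerivAt (fun t => Real.exp (-(Q * t)) * ∫ w, f w ∂(μ.prod ν))
      (-Q * ∫ w, f w ∂(μ.prod ν)) 0 := by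
    have : HasDerivAt (fun t : ℝ => -(Q * t)) (-Q) 0 := by
      simpa using ((hasDerivAt_id (0 : ℝ)).const_mul Q).fun_neg
    simpa using this.exp.mul_const (∫ w, f w ∂(μ.prod ν))
  have h3 := h2.congr_of_eventuallyEq (f₁ := fun t => ∫ w, f (expDilation α t w) ∂(μ.prod ν))
    (Filter.mem_of_superset hball fun t ht =>
      integral_comp_expDilation μ ν hα (by simpa using (mem_ball_zero_iff.1 ht).le) hf hfs)
  have h4 := h1.unique h3
  simp only [expDilation_zero] at h4
  rw [h4, neg_mul]

end Dilation

section Weight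

/-- The radial weight `uˢ / (1 + u) · exp (-uˢ)`. -/
noncomputable def radialWeight (s u : ℝ) : ℝ :=
  u ^ s / (1 + u) * Real.exp (-u ^ s)

/-- The logarithmic derivative `u · d/du` of `radialWeight s`. -/
noncomputable def radialWeightDeriv (s u : ℝ) : ℝ :=
  (u ^ s / (1 + u) * (s - u / (1 + u)) - s * u ^ s * (u ^ s / (1 + u))) * Real.exp (-u ^ s)

theorem continuousOn_radialWeight {s : ℝ} (hs : 0 ≤ s) :
    ContinuousOn (radialWeight s) (Set.Ici 0) := by
  have h : ∀ u ∈ Set.Ici (0 : ℝ), 1 + u ≠ 0 := fun u (hu : 0 ≤ u) => by positivity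
  have h' := (Real.continuous_rpow_const hs).continuousOn (s := Set.Ici (0 : ℝ))
  unfold radialWeight
  fun_prop (disch := assumption)

theorem continuousOn_radialWeightDeriv {s : ℝ} (hs : 0 ≤ s) :
    ContinuousOn (radialWeightDeriv s) (Set.Ici 0) := by
  have h : ∀ u ∈ Set.Ici (0 : ℝ), 1 + u ≠ 0 := fun u (hu : 0 ≤ u) => by positivity
  have h' := (Real.continuous_rpow_const hs).continuousOn (s := Set.Ici (0 : ℝ))
  unfold radialWeightDeriv
  fun_prop (disch := assumption)

theorem hasDerivAt_radialWeight_exp_mul {s : ℝ} (hs : 0 < s) {u : ℝ} (hu : 0 ≤ u) (c t : ℝ) :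
    HasDerivAt (fun t => radialWeight s (Real.exp (c * t) * u))
      (c * radialWeightDeriv s (Real.exp (c * t) * u)) t := by
  rcases hu.eq_or_lt with rfl | hu
  · simpa [radialWeightDeriv, Real.zero_rpow hs.ne'] using
      hasDerivAt_const t (radialWeight s 0)
  have hv : HasDerivAt (fun t => Real.exp (c * t) * u) (c * (Real.exp (c * t) * u)) t := by
    refine ((((hasDerivAt_id t).const_mul c).exp).mul_const u).congr_deriv ?_
    simp
    ring
  have hpos : 0 < Real.exp (c * t) * u := by positivity
  set v := Real.exp (c * t) * u
  have hrad : HasDerivAt (radialWeight s) (radialWeightDeriv s v / v) v := by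
    have h1 : HasDerivAt (fun u : ℝ => u ^ s) (s * v ^ (s - 1)) v :=
      Real.hasDerivAt_rpow_const (Or.inl hpos.ne')
    have h2 : HasDerivAt (fun u : ℝ => 1 + u) 1 v := (hasDerivAt_id v).const_add 1
    have h3 := (h1.fun_div h2 (by positivity)).fun_mul h1.fun_neg.exp
    refine h3.congr_deriv ?_
    rw [Real.rpow_sub_one hpos.ne', radialWeightDeriv]
    field_simp
    ring
  refine (HasDerivAt.comp t (h₂ := radialWeight s) hrad hv).congr_deriv ?_
  field_simp

end Weight

section Gauge

variable {E F : Type*} [NormedAddCommGroup E] [NormedAddCommGroup F]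

/-- The power `N^{2+2γ}` of the Kaplan norm. -/
noncomputable def grushinGauge (γ : ℝ) (w : E × F) : ℝ :=
  ‖w.1‖ ^ (2 * (1 + γ)) + (1 + γ) ^ 2 * ‖w.2‖ ^ 2

theorem grushinGauge_nonneg (γ : ℝ) (w : E × F) : 0 ≤ grushinGauge γ w := by
  unfold grushinGauge
  positivity

theorem continuous_norm_fst_rpow {q : ℝ} (hq : 0 ≤ q) :
    Continuous fun w : E × F => ‖w.1‖ ^ q :=
  (Real.continuous_rpow_const hq).comp continuous_fst.norm

theorem continuous_grushinGauge {γ : ℝ} (hγ : 0 ≤ γ) :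
    Continuous (grushinGauge γ : E × F → ℝ) := by
  have := continuous_norm_fst_rpow (E := E) (F := F) (q := 2 * (1 + γ)) (by positivity)
  unfold grushinGauge
  fun_prop

theorem norm_fst_rpow_le {γ : ℝ} (hγ : 0 ≤ γ) {R : ℝ} {w : E × F}
    (h : grushinGauge γ w ≤ R) : ‖w.1‖ ^ (2 * γ) ≤ R ^ (γ / (1 + γ)) := by
  have h1 : ‖w.1‖ ^ (2 * γ) = (‖w.1‖ ^ (2 * (1 + γ))) ^ (γ / (1 + γ)) := by
    rw [← Real.rpow_mul (norm_nonneg _)]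
    congr 1
    field_simp
  rw [h1]
  refine Real.rpow_le_rpow (by positivity) (le_trans ?_ h) (by positivity)
  exact le_add_of_nonneg_right (by positivity)

variable [NormedSpace ℝ E] [NormedSpace ℝ F]

theorem norm_fst_expDilation_rpow (α t q : ℝ) (w : E × F) :
    ‖(expDilation α t w).1‖ ^ q = Real.exp (q * t) * ‖w.1‖ ^ q := by
  rw [expDilation, norm_smul, Real.norm_eq_abs, Real.abs_exp,
    Real.mul_rpow (by positivity) (by positivity), ← Real.exp_mul, mul_comm t]

theorem grushinGauge_expDilation (γ t : ℝ) (w : E × F) :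
    grushinGauge γ (expDilation (1 + γ) t w) =
      Real.exp (2 * (1 + γ) * t) * grushinGauge γ w := by
  rw [grushinGauge, norm_fst_expDilation_rpow, grushinGauge, expDilation, norm_smul,
    Real.norm_eq_abs, Real.abs_exp, mul_pow, ← Real.exp_nat_mul]
  push_cast
  ring_nf

/-- The derivative of `f` along the generator of the dilations. -/
noncomputable def dilationDeriv (α : ℝ) (f : E × F → ℝ) (w : E × F) : ℝ :=
  fderiv ℝ f w (w.1, α • w.2)

theorem hasDerivAt_comp_expDilation {f : E × F → ℝ} (hf : Differentiable ℝ f) (α t : ℝ)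
    (w : E × F) :
    HasDerivAt (fun t => f (expDilation α t w)) (dilationDeriv α f (expDilation α t w)) t := by
  have h1 : HasDerivAt (fun t => expDilation α t w)
      (Real.exp t • w.1, α • Real.exp (α * t) • w.2) t := by
    refine HasDerivAt.prodMk ((Real.hasDerivAt_exp t).smul_const w.1) ?_
    have h2 : HasDerivAt (fun t => Real.exp (α * t)) (Real.exp (α * t) * α) t := by
      simpa using ((hasDerivAt_id t).const_mul α).exp
    refine (h2.smul_const w.2).congr_deriv ?_
    rw [smul_smul, mul_comm]
  exact (hf _).hasFDerivAt.comp_hasDerivAt t h1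

theorem continuous_dilationDeriv {f : E × F → ℝ} (hf : ContDiff ℝ (⊤ : ℕ∞) f) (α : ℝ) :
    Continuous (dilationDeriv α f) := by
  have := hf.continuous_fderiv (by simp)
  unfold dilationDeriv
  fun_prop

variable [FiniteDimensional ℝ E] [FiniteDimensional ℝ F] [MeasurableSpace E] [BorelSpace E]
  [MeasurableSpace F] [BorelSpace F] (μ : Measure E) (ν : Measure F)
  [μ.IsAddHaarMeasure] [ν.IsAddHaarMeasure]

theorem integral_sq_mul_radialWeight {γ s : ℝ} (hγ : 0 ≤ γ) (hs : 0 < s) {f : E × F → ℝ}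
    (hf : ContDiff ℝ (⊤ : ℕ∞) f) (hfs : HasCompactSupport f) :
    Integrable (fun w : E × F => ‖w.1‖ ^ (2 * γ) *
      (2 * f w * dilationDeriv (1 + γ) f w * radialWeight s (grushinGauge γ w) +
        f w ^ 2 * (2 * (1 + γ) * radialWeightDeriv s (grushinGauge γ w) +
          (Module.finrank ℝ E + Module.finrank ℝ F * (1 + γ) + 2 * γ) *
            radialWeight s (grushinGauge γ w)))) (μ.prod ν) ∧
    ∫ w : E × F, ‖w.1‖ ^ (2 * γ) *
      (2 * f w * dilationDeriv (1 + γ) f w * radialWeight s (grushinGauge γ w) +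
        f w ^ 2 * (2 * (1 + γ) * radialWeightDeriv s (grushinGauge γ w) +
          (Module.finrank ℝ E + Module.finrank ℝ F * (1 + γ) + 2 * γ) *
            radialWeight s (grushinGauge γ w))) ∂(μ.prod ν) = 0 := by
  have hcf := hf.continuous
  have hcD := continuous_dilationDeriv hf (1 + γ)
  have hcX := continuous_norm_fst_rpow (E := E) (F := F) (q := 2 * γ) (by positivity)
  have hcr : Continuous fun w : E × F => radialWeight s (grushinGauge γ w) :=
    (continuousOn_radialWeight hs.le).comp_continuous (continuous_grushinGauge hγ)
      (grushinGauge_nonneg γ)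
  have hck : Continuous fun w : E × F => radialWeightDeriv s (grushinGauge γ w) :=
    (continuousOn_radialWeightDeriv hs.le).comp_continuous (continuous_grushinGauge hγ)
      (grushinGauge_nonneg γ)
  have hsupp (g : E × F → ℝ) (hg : ∀ w, f w = 0 → g w = 0) : HasCompactSupport g :=
    hfs.mono fun w hw h => hw (hg w h)
  set G : E × F → ℝ := fun w =>
    f w ^ 2 * (‖w.1‖ ^ (2 * γ) * radialWeight s (grushinGauge γ w)) with hG
  set G' : E × F → ℝ := fun w =>
    2 * f w * dilationDeriv (1 + γ) f w * (‖w.1‖ ^ (2 * γ) * radialWeight s (grushinGauge γ w)) +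
    f w ^ 2 * (2 * γ * ‖w.1‖ ^ (2 * γ) * radialWeight s (grushinGauge γ w) +
      ‖w.1‖ ^ (2 * γ) * (2 * (1 + γ) * radialWeightDeriv s (grushinGauge γ w))) with hG'
  have hcG : Continuous G := by fun_prop
  have hcG' : Continuous G' := by fun_prop
  have hsG : HasCompactSupport G := hsupp _ fun w h => by simp [hG, h]
  have hsG' : HasCompactSupport G' := hsupp _ fun w h => by simp [hG', h]
  have key := integral_expDilation_deriv μ ν (α := 1 + γ) (by linarith) hcG hsG hcG' hsG' (by
    intro w t
    have h1 := hasDerivAt_comp_expDilation (hf.differentiable (by simp)) (1 + γ) t w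
    have h2 : HasDerivAt (fun t => Real.exp (2 * γ * t) * ‖w.1‖ ^ (2 * γ))
        (2 * γ * (Real.exp (2 * γ * t) * ‖w.1‖ ^ (2 * γ))) t := by
      refine ((((hasDerivAt_id t).const_mul (2 * γ)).exp).mul_const _).congr_deriv ?_
      simp
      ring
    have h3 := hasDerivAt_radialWeight_exp_mul hs (grushinGauge_nonneg γ w) (2 * (1 + γ)) t
    have h4 := (h1.fun_pow 2).fun_mul (h2.fun_mul h3)
    simp only [hG, hG', norm_fst_expDilation_rpow, grushinGauge_expDilation]
    refine h4.congr_deriv ?_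
    push_cast
    ring)
  have hi := hcG.integrable_of_hasCompactSupport (μ := μ.prod ν) hsG
  have hi' := hcG'.integrable_of_hasCompactSupport (μ := μ.prod ν) hsG'
  have heq : (fun w : E × F => ‖w.1‖ ^ (2 * γ) *
      (2 * f w * dilationDeriv (1 + γ) f w * radialWeight s (grushinGauge γ w) +
        f w ^ 2 * (2 * (1 + γ) * radialWeightDeriv s (grushinGauge γ w) +
          (Module.finrank ℝ E + Module.finrank ℝ F * (1 + γ) + 2 * γ) *
            radialWeight s (grushinGauge γ w)))) =
      fun w => G' w + (Module.finrank ℝ E + Module.finrank ℝ F * (1 + γ)) * G w := by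
    funext w
    simp only [hG, hG']
    ring
  rw [heq]
  refine ⟨hi'.add (hi.const_mul _), ?_⟩
  rw [integral_add hi' (hi.const_mul _), key, integral_const_mul]
  ring

end Gauge

section Pointwise

theorem mul_rpow_two_mul_sub_one_le {s u X : ℝ} (hs : 1 / 2 < s) (hu : 0 ≤ u) (hX : 0 ≤ X)
    (hX1 : u ≤ 1 → X ≤ 1) :
    X * u ^ (2 * s - 1) ≤ 2 * (X * (u ^ s * (u ^ s / (1 + u)))) + 1 := by
  rcases le_total u 1 with h | h
  · have h1 : u ^ (2 * s - 1) ≤ 1 := Real.rpow_le_one hu h (by linarith)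
    have h2 : X * u ^ (2 * s - 1) ≤ 1 := mul_le_one₀ (hX1 h) (by positivity) h1
    have h3 : 0 ≤ 2 * (X * (u ^ s * (u ^ s / (1 + u)))) := by positivity
    linarith
  · have hu' : 0 < u := by linarith
    have h1 : u ^ (2 * s - 1) = u ^ s * (u ^ s / u) := by
      rw [Real.rpow_sub_one hu'.ne', two_mul, Real.rpow_add hu', mul_div_assoc]
    have h2 : u ^ s / u ≤ 2 * (u ^ s / (1 + u)) := by
      rw [← mul_div_assoc, div_le_div_iff₀ hu' (by linarith)]
      have : 0 ≤ u ^ s := by positivity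
      nlinarith
    have h3 : X * u ^ (2 * s - 1) ≤ X * (u ^ s * (2 * (u ^ s / (1 + u)))) := by
      rw [h1]
      gcongr
    linarith

theorem mul_sub_rpow_le {s u X p q B : ℝ} (hs : 0 < s) (hp : 0 < p) (hq : 0 ≤ q) (hu : 0 ≤ u)
    (hX : 0 ≤ X) (hB : 0 ≤ B) (hXB : u ≤ (2 * q / p) ^ s⁻¹ → X ≤ B) :
    X * (u ^ s / (1 + u) * (q - p / 2 * u ^ s)) ≤ B * (2 * q / p * q) := by
  have hus : 0 ≤ u ^ s := by positivity
  have hψ : 0 ≤ u ^ s / (1 + u) := by positivity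
  rcases le_total (u ^ s) (2 * q / p) with h | h
  · have hu' : u ≤ (2 * q / p) ^ s⁻¹ := (Real.le_rpow_inv_iff_of_pos hu (by positivity) hs).2 h
    have h1 : u ^ s / (1 + u) ≤ 2 * q / p :=
      (div_le_self hus (by linarith)).trans h
    calc X * (u ^ s / (1 + u) * (q - p / 2 * u ^ s)) ≤ X * (u ^ s / (1 + u) * q) := by
          gcongr
          have : 0 ≤ p / 2 * u ^ s := by positivity
          linarith
      _ ≤ B * (2 * q / p * q) := by
          gcongr
          exact hXB hu'
  · have h1 : q - p / 2 * u ^ s ≤ 0 := by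
      rw [div_le_iff₀ hp] at h
      linarith
    have h2 : X * (u ^ s / (1 + u) * (q - p / 2 * u ^ s)) ≤ 0 :=
      mul_nonpos_of_nonneg_of_nonpos hX (mul_nonpos_of_nonneg_of_nonpos hψ h1)
    exact h2.trans (by positivity)

theorem two_mul_le_of_mul_sq_le {X D u G ψ φ p : ℝ} (hX : 0 ≤ X) (hu : 0 ≤ u) (hG : 0 ≤ G)
    (hp : 0 < p) (h : X * D ^ 2 ≤ u * G) :
    2 * (X * (φ * D * ψ)) ≤ p / 4 * (X * (u * ψ ^ 2 * φ ^ 2)) + 4 / p * G := by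
  have hsq : (X * (φ * D * ψ)) ^ 2 ≤ (p / 4 * (X * (u * ψ ^ 2 * φ ^ 2))) * (4 / p * G) := by
    calc (X * (φ * D * ψ)) ^ 2 = X * φ ^ 2 * ψ ^ 2 * (X * D ^ 2) := by ring
      _ ≤ X * φ ^ 2 * ψ ^ 2 * (u * G) := by gcongr
      _ = _ := by field_simp
  have ha : 0 ≤ p / 4 * (X * (u * ψ ^ 2 * φ ^ 2)) := by positivity
  have hb : 0 ≤ 4 / p * G := by positivity
  refine le_trans (le_abs_self _) (abs_le_of_sq_le_sq ?_ (by positivity))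
  nlinarith [sq_nonneg (p / 4 * (X * (u * ψ ^ 2 * φ ^ 2)) - 4 / p * G)]

/-- The integrand of the U-bound is controlled by the energy up to a divergence. -/
theorem weighted_sq_le {α s u X D G φ p d B : ℝ} (hα : 0 < α) (hs : 1 / 2 < s)
    (hp : 2 * α * s = p) (hd : 0 ≤ d) (hu : 0 ≤ u) (hX : 0 ≤ X) (hG : 0 ≤ G) (hB : 0 ≤ B)
    (hX1 : u ≤ 1 → X ≤ 1) (hXB : u ≤ (2 * (p + d) / p) ^ s⁻¹ → X ≤ B)
    (h : X * D ^ 2 ≤ u * G) :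
    p / 8 * (X * u ^ (2 * s - 1) * φ ^ 2 * Real.exp (-u ^ s)) ≤
      4 / p * (G * Real.exp (-u ^ s)) +
      (B * (2 * (p + d) / p * (p + d)) + p / 8) * (φ ^ 2 * Real.exp (-u ^ s)) -
      X * (2 * φ * D * radialWeight s u +
        φ ^ 2 * (2 * α * radialWeightDeriv s u + d * radialWeight s u)) := by
  have hp0 : 0 < p := by rw [← hp]; positivity
  have h1 := mul_le_mul_of_nonneg_right (mul_rpow_two_mul_sub_one_le hs hu hX hX1) (sq_nonneg φ)
  have h2 := mul_le_mul_of_nonneg_right (mul_sub_rpow_le (q := p + d) (by linarith) hp0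
    (by linarith) hu hX hB hXB) (sq_nonneg φ)
  have h3 := two_mul_le_of_mul_sq_le (ψ := u ^ s / (1 + u)) (φ := φ) hX hu hG hp0 h
  have hψ : 0 ≤ u ^ s / (1 + u) := by positivity
  have h4 : X * (u * (u ^ s / (1 + u)) ^ 2 * φ ^ 2) ≤
      X * (u ^ s * (u ^ s / (1 + u)) * φ ^ 2) := by
    have : u * (u ^ s / (1 + u)) ≤ u ^ s := by
      rw [← mul_div_assoc, div_le_iff₀ (by linarith)]
      nlinarith [show 0 ≤ u ^ s by positivity]
    rw [pow_two, ← mul_assoc u]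
    gcongr
  have h5 : 0 ≤ X * φ ^ 2 * (2 * α * (u ^ s / (1 + u) * (u / (1 + u)))) := by positivity
  have h6 : p / 8 * (X * u ^ (2 * s - 1) * φ ^ 2) ≤ 4 / p * G +
      (B * (2 * (p + d) / p * (p + d)) + p / 8) * φ ^ 2 -
      X * (2 * φ * D * (u ^ s / (1 + u)) +
        φ ^ 2 * (2 * α * (u ^ s / (1 + u) * (s - u / (1 + u)) - s * u ^ s * (u ^ s / (1 + u))) +
          d * (u ^ s / (1 + u)))) := by
    have h7 : X * (2 * φ * D * (u ^ s / (1 + u)) +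
        φ ^ 2 * (2 * α * (u ^ s / (1 + u) * (s - u / (1 + u)) - s * u ^ s * (u ^ s / (1 + u))) +
          d * (u ^ s / (1 + u)))) =
        2 * (X * (φ * D * (u ^ s / (1 + u)))) -
          X * φ ^ 2 * (2 * α * (u ^ s / (1 + u) * (u / (1 + u)))) +
          (p + d) * (X * φ ^ 2 * (u ^ s / (1 + u))) -
          p * (X * (u ^ s * (u ^ s / (1 + u)) * φ ^ 2)) := by
      rw [← hp]
      ring
    rw [h7]
    generalize u ^ s / (1 + u) = ψ at *
    have h8 := mul_le_mul_of_nonneg_left h1 (show 0 ≤ p / 8 by positivity)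
    have h9 := mul_le_mul_of_nonneg_left h4 (show 0 ≤ p / 4 by positivity)
    linarith
  have h7 := mul_le_mul_of_nonneg_right h6 (Real.exp_pos (-u ^ s)).le
  rw [radialWeight, radialWeightDeriv]
  linarith

end Pointwise

section Grushin

variable {n m : ℕ} {γ p : ℝ}
  {f : EuclideanSpace ℝ (Fin n) × EuclideanSpace ℝ (Fin m) → ℝ}

theorem gradSqG_nonneg (n m : ℕ) (γ : ℝ)
    (f : EuclideanSpace ℝ (Fin n) × EuclideanSpace ℝ (Fin m) → ℝ)
    (w : EuclideanSpace ℝ (Fin n) × EuclideanSpace ℝ (Fin m)) : 0 ≤ gradSqG n m γ f w := by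
  unfold gradSqG
  positivity

theorem continuous_gradSqG (hγ : 0 ≤ γ) (hf : ContDiff ℝ (⊤ : ℕ∞) f) :
    Continuous (gradSqG n m γ f) := by
  have h1 := hf.continuous_fderiv (by simp)
  have h2 := continuous_norm_fst_rpow (E := EuclideanSpace ℝ (Fin n))
    (F := EuclideanSpace ℝ (Fin m)) (q := 2 * γ) (by positivity)
  unfold gradSqG dX dY
  fun_prop

theorem hasCompactSupport_gradSqG (hfs : HasCompactSupport f) :
    HasCompactSupport (gradSqG n m γ f) :=
  (hfs.fderiv ℝ).mono fun w hw h => hw (by simp [gradSqG, dX, dY, h])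

theorem dilationDeriv_eq_sum (α : ℝ) (w : EuclideanSpace ℝ (Fin n) × EuclideanSpace ℝ (Fin m)) :
    dilationDeriv α f w =
      ∑ i, w.1 i * dX n m f w i + α * ∑ j, w.2 j * dY n m f w j := by
  have h : (w.1, α • w.2) = ∑ i, w.1 i • (EuclideanSpace.single i (1 : ℝ),
      (0 : EuclideanSpace ℝ (Fin m))) +
      α • ∑ j, w.2 j • ((0 : EuclideanSpace ℝ (Fin n)), EuclideanSpace.single j (1 : ℝ)) := by
    have e1 := (EuclideanSpace.basisFun (Fin n) ℝ).sum_repr w.1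
    have e2 := (EuclideanSpace.basisFun (Fin m) ℝ).sum_repr w.2
    simp only [EuclideanSpace.basisFun_repr, EuclideanSpace.basisFun_apply] at e1 e2
    ext1
    · simp [Prod.fst_sum, e1]
    · simp [Prod.snd_sum, e2]
  rw [dilationDeriv, h]
  simp only [map_add, map_smul, map_sum, smul_eq_mul, dX, dY]

theorem norm_rpow_mul_dilationDeriv_sq_le (hγ : 0 ≤ γ)
    (w : EuclideanSpace ℝ (Fin n) × EuclideanSpace ℝ (Fin m)) :
    ‖w.1‖ ^ (2 * γ) * dilationDeriv (1 + γ) f w ^ 2 ≤ grushinGauge γ w * gradSqG n m γ f w := by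
  have hA := Finset.sum_mul_sq_le_sq_mul_sq Finset.univ w.1 (dX n m f w)
  have hB := Finset.sum_mul_sq_le_sq_mul_sq Finset.univ w.2 (dY n m f w)
  rw [← EuclideanSpace.real_norm_sq_eq] at hA hB
  have hX : ‖w.1‖ ^ (2 * (1 + γ)) = ‖w.1‖ ^ (2 * γ) * ‖w.1‖ ^ 2 := by
    rw [mul_add, mul_one, add_comm, Real.rpow_add_of_nonneg (norm_nonneg _) (by positivity)
      (by positivity), Real.rpow_two]
  rw [dilationDeriv_eq_sum, grushinGauge, gradSqG, hX]
  have hg₁ : 0 ≤ ∑ i, dX n m f w i ^ 2 := by positivity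
  have hg₂ : 0 ≤ ∑ j, dY n m f w j ^ 2 := by positivity
  have hX0 : 0 ≤ ‖w.1‖ ^ (2 * γ) := by positivity
  generalize ∑ i, w.1 i * dX n m f w i = A at *
  generalize ∑ j, w.2 j * dY n m f w j = B at *
  generalize ∑ i, dX n m f w i ^ 2 = g₁ at *
  generalize ∑ j, dY n m f w j ^ 2 = g₂ at *
  generalize ‖w.1‖ ^ (2 * γ) = X at *
  generalize ‖w.1‖ = x at *
  generalize ‖w.2‖ = y at *
  have hcross : 2 * (X * (1 + γ) * (A * B)) ≤
      X * x ^ 2 * (X * g₂) + (1 + γ) ^ 2 * y ^ 2 * g₁ := by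
    refine (le_abs_self _).trans (abs_le_of_sq_le_sq ?_ (by positivity))
    have hAB : A ^ 2 * B ^ 2 ≤ (x ^ 2 * g₁) * (y ^ 2 * g₂) := by gcongr
    have := mul_le_mul_of_nonneg_left hAB (show 0 ≤ 4 * (X * (1 + γ)) ^ 2 by positivity)
    nlinarith [sq_nonneg (X * x ^ 2 * (X * g₂) - (1 + γ) ^ 2 * y ^ 2 * g₁)]
  have h1 := mul_le_mul_of_nonneg_left hA hX0
  have h2 := mul_le_mul_of_nonneg_left hB (show 0 ≤ X * (1 + γ) ^ 2 by positivity)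
  linarith

theorem GKaplan_rpow (q : ℝ) (w : EuclideanSpace ℝ (Fin n) × EuclideanSpace ℝ (Fin m)) :
    GKaplan n m γ w ^ q = grushinGauge γ w ^ (q / (2 * (1 + γ))) := by
  rw [GKaplan, ← Real.rpow_mul (by positivity), grushinGauge]
  ring_nf

theorem integral_muG (hγ : 0 ≤ γ) (hp : 0 ≤ p)
    (g : EuclideanSpace ℝ (Fin n) × EuclideanSpace ℝ (Fin m) → ℝ) :
    ∫ w, g w ∂(muG n m γ p) =
      (∫ v : EuclideanSpace ℝ (Fin n) × EuclideanSpace ℝ (Fin m),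
        Real.exp (-(GKaplan n m γ v) ^ p))⁻¹ *
      ∫ w, g w * Real.exp (-grushinGauge γ w ^ (p / (2 * (1 + γ)))) := by
  have hZ : 0 ≤ (∫ v : EuclideanSpace ℝ (Fin n) × EuclideanSpace ℝ (Fin m),
      Real.exp (-(GKaplan n m γ v) ^ p))⁻¹ :=
    inv_nonneg.2 (integral_nonneg fun _ => (Real.exp_pos _).le)
  have hc : Continuous fun w : EuclideanSpace ℝ (Fin n) × EuclideanSpace ℝ (Fin m) =>
      GKaplan n m γ w ^ p := by
    simp_rw [GKaplan_rpow]
    exact (Real.continuous_rpow_const (by positivity)).comp (continuous_grushinGauge hγ)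
  rw [muG, integral_withDensity_eq_integral_toReal_smul
    (hc.fun_neg.rexp.const_mul _).measurable.ennreal_ofReal
    (Filter.Eventually.of_forall fun _ => ENNReal.ofReal_lt_top), ← integral_const_mul]
  congr 1 with w
  rw [ENNReal.toReal_ofReal (mul_nonneg hZ (Real.exp_pos _).le), smul_eq_mul, ← GKaplan_rpow]
  ring

end Grushin

/-- `U`-bound in `L²` in the Grushin setting for `dμ = Z⁻¹ e^{-N^p} dξ`, `γ ≥ 0`,
`p > γ + 1`: `∫ |x|^{2γ} N^{2(p-γ-1)} f² dμ ≤ C(∫ |∇_γ f|² dμ + ∫ f² dμ)`. -/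
theorem ubound_L2_grushin (n m : ℕ) (hn : 1 ≤ n) (hm : 1 ≤ m) (γ p : ℝ)
    (hγ : 0 ≤ γ) (hp : γ + 1 < p) :
    ∃ C > 0, ∀ f : EuclideanSpace ℝ (Fin n) × EuclideanSpace ℝ (Fin m) → ℝ,
      ContDiff ℝ (⊤ : ℕ∞) f → HasCompactSupport f →
      ∫ w, ‖w.1‖ ^ (2 * γ) * (GKaplan n m γ w) ^ (2 * (p - γ - 1)) * (f w) ^ 2
          ∂(muG n m γ p) ≤
        C * ((∫ w, gradSqG n m γ f w ∂(muG n m γ p)) +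
             (∫ w, (f w) ^ 2 ∂(muG n m γ p))) := by
  have hs : 1 / 2 < p / (2 * (1 + γ)) := by
    rw [div_lt_div_iff₀ (by norm_num) (by positivity)]
    linarith
  have hps : 2 * (1 + γ) * (p / (2 * (1 + γ))) = p := by field_simp
  have hs' : 2 * (p - γ - 1) / (2 * (1 + γ)) = 2 * (p / (2 * (1 + γ))) - 1 := by
    field_simp
    ring
  have hp0 : 0 < p := by linarith
  have hd : 0 ≤ (n : ℝ) + m * (1 + γ) + 2 * γ := by positivity
  set s := p / (2 * (1 + γ))
  set d := (n : ℝ) + m * (1 + γ) + 2 * γ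
  set B := ((2 * (p + d) / p) ^ s⁻¹) ^ (γ / (1 + γ))
  set C := B * (2 * (p + d) / p * (p + d)) + p / 8
  have hC : 0 < C := by positivity
  refine ⟨8 / p * (4 / p + C), by positivity, fun f hf hfs => ?_⟩
  rw [integral_muG hγ hp0.le, integral_muG hγ hp0.le, integral_muG hγ hp0.le, ← mul_add,
    mul_left_comm]
  refine mul_le_mul_of_nonneg_left ?_
    (inv_nonneg.2 (integral_nonneg fun _ => (Real.exp_pos _).le))
  have hs_def : p / (2 * (1 + γ)) = s := rfl
  simp_rw [GKaplan_rpow, hs', hs_def]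
  have hcu : Continuous (grushinGauge γ :
    EuclideanSpace ℝ (Fin n) × EuclideanSpace ℝ (Fin m) → ℝ) := continuous_grushinGauge hγ
  have hcX := continuous_norm_fst_rpow (E := EuclideanSpace ℝ (Fin n))
    (F := EuclideanSpace ℝ (Fin m)) (q := 2 * γ) (by positivity)
  have hcT := hcu.rpow_const fun _ => Or.inr (show 0 ≤ 2 * s - 1 by linarith)
  have hcE := (hcu.rpow_const fun _ => Or.inr (show 0 ≤ s by linarith)).fun_neg.rexp
  have hf2 : HasCompactSupport fun w => f w ^ 2 := hfs.mono fun w hw h => hw (by simp [h])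
  have hiT : Integrable fun w => ‖w.1‖ ^ (2 * γ) * grushinGauge γ w ^ (2 * s - 1) * f w ^ 2 *
      Real.exp (-grushinGauge γ w ^ s) :=
    (((hcX.mul hcT).mul (hf.continuous.pow 2)).mul hcE).integrable_of_hasCompactSupport
      hf2.mul_left.mul_right
  have hiG : Integrable fun w => gradSqG n m γ f w * Real.exp (-grushinGauge γ w ^ s) :=
    ((continuous_gradSqG hγ hf).mul hcE).integrable_of_hasCompactSupport
      (hasCompactSupport_gradSqG hfs).mul_right
  have hif : Integrable fun w => f w ^ 2 * Real.exp (-grushinGauge γ w ^ s) :=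
    ((hf.continuous.pow 2).mul hcE).integrable_of_hasCompactSupport hf2.mul_right
  obtain ⟨hiI, hI⟩ := integral_sq_mul_radialWeight
    (volume : Measure (EuclideanSpace ℝ (Fin n))) (volume : Measure (EuclideanSpace ℝ (Fin m)))
    hγ (show 0 < s by linarith) hf hfs
  simp only [finrank_euclideanSpace_fin] at hiI hI
  rw [← Measure.volume_eq_prod] at hiI hI
  have hle := integral_mono (hiT.const_mul (p / 8))
    (((hiG.const_mul (4 / p)).add (hif.const_mul C)).sub hiI) fun w =>
      weighted_sq_le (α := 1 + γ) (φ := f w) (B := B) (by positivity) hs hps hd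
        (grushinGauge_nonneg γ w) (by positivity) (gradSqG_nonneg n m γ f w) (by positivity)
        (fun h => (norm_fst_rpow_le hγ h).trans_eq (Real.one_rpow _))
        (fun h => norm_fst_rpow_le hγ h) (norm_rpow_mul_dilationDeriv_sq_le hγ w)
  rw [integral_const_mul, integral_sub' ((hiG.const_mul _).add (hif.const_mul _)) hiI, hI,
    integral_add' (hiG.const_mul _) (hif.const_mul _), integral_const_mul, integral_const_mul,
    sub_zero] at hle
  have hG0 : 0 ≤ ∫ w, gradSqG n m γ f w * Real.exp (-grushinGauge γ w ^ s) :=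
    integral_nonneg fun w => mul_nonneg (gradSqG_nonneg n m γ f w) (Real.exp_pos _).le
  have hf0 : 0 ≤ ∫ w, f w ^ 2 * Real.exp (-grushinGauge γ w ^ s) :=
    integral_nonneg fun w => by positivity
  have h1 := mul_nonneg hC.le hG0
  have h2 := mul_nonneg (show 0 ≤ 4 / p by positivity) hf0
  rw [mul_assoc, ← inv_div, ← div_eq_inv_mul, le_div_iff₀' (by positivity)]
  linarith
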